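/- Let K be an algebraically closed field, R = K[x_1,…,x_N] a polynomial ring over K, n ≥ 3 an integer, and X a (2×n)-matrix whose entries are linear forms (homogeneous polynomials of degree 1) in R that are linearly dependent over K. Then ara I_2(X) ≤ 2n − 4. -/

import Mathlib

/-- The ideal generated by the `t × t` minors of a matrix. -/
def minorsIdeal {R : Type*} [CommRing R] {m n : ℕ} (t : ℕ)
    (X : Matrix (Fin m) (Fin n) R) : Ideal R :=
  Ideal.span { d | ∃ (r : Fin t → Fin m) (c : Fin t → Fin n),
    Function.Injective r ∧ Function.Injective c ∧ d = (X.submatrix r c).det }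

/-- The arithmetical rank of an ideal: the least number of elements generating it
up to radical. -/
noncomputable def araRank {R : Type*} [CommRing R] (I : Ideal R) : ℕ :=
  sInf { r | ∃ f : Fin r → R, (Ideal.span (Set.range f)).radical = I.radical }

/-- the 2-minor of columns `i`, `j` of the matrix with rows `a`, `b` -/
def mnr {R ι : Type*} [CommRing R] (a b : ι → R) (i j : ι) : R := a i * b j - a j * b i

/-- the sum of `g i j` over `i < j < n`, `i + j = k` -/
def dsum {R : Type*} [CommRing R] (n : ℕ) (g : ℕ → ℕ → R) (k : ℕ) : R :=
  ∑ p ∈ (Finset.range n ×ˢ Finset.range n).filter (fun p => p.1 < p.2 ∧ p.1 + p.2 = k), g p.1 p.2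

lemma map_dsum {R S : Type*} [CommRing R] [CommRing S] (φ : R →+* S) (n : ℕ) (g : ℕ → ℕ → R)
    (k : ℕ) : φ (dsum n g k) = dsum n (fun i j => φ (g i j)) k := by
  simp [dsum, map_sum]

lemma dsum_eq_zero {R : Type*} [CommRing R] (n : ℕ) (g : ℕ → ℕ → R) (k : ℕ)
    (h : ∀ i j, i < j → j < n → g i j = 0) : dsum n g k = 0 := by
  apply Finset.sum_eq_zero
  rintro ⟨i, j⟩ hp
  simp only [Finset.mem_filter, Finset.mem_product, Finset.mem_range] at hp
  exact h i j hp.2.1 hp.1.2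

lemma chain {L : Type*} [Field L] (a b : ℕ → L) (g : ℕ → ℕ → L) (n T : ℕ)
    (hg : ∀ i j, i < j → j < n → (g i j = 0 ↔ mnr a b i j = 0))
    (hS : ∀ k, 1 ≤ k → k ≤ T → dsum n g k = 0) :
    ∀ k, k ≤ T → ∀ i j, i < j → j < n → i + j = k → mnr a b i j = 0 := by
  intro k
  induction k using Nat.strong_induction_on with
  | _ k ih =>
    intro hk i j hij hj hijk
    by_contra hne
    have hlow : ∀ p q, p < q → q < n → p + q < k → mnr a b p q = 0 := fun p q h1 h2 h3 =>
      ih (p + q) h3 (by omega) p q h1 h2 rfl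
    -- outer times inner pair vanishes
    have hprod : ∀ p q p' q', p < p' → p' < q' → q' < q → q < n → p + q = k → p' + q' = k →
        mnr a b p q * mnr a b p' q' = 0 := by
      intro p q p' q' h1 h2 h3 h4 h5 h6
      have e1 := hlow p p' h1 (by omega) (by omega)
      have e2 := hlow p q' (by omega) (by omega) (by omega)
      have : mnr a b p q * mnr a b p' q' =
          mnr a b p q' * mnr a b p' q - mnr a b p p' * mnr a b q' q := by
        simp only [mnr]; ring
      rw [this, e1, e2]; ring
    have hs := hS k (by omega) hk
    unfold dsum at hs
    rw [Finset.sum_eq_single (i, j)] at hs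
    · exact hne ((hg i j hij hj).1 hs)
    · rintro ⟨p, q⟩ hp hpne
      simp only [Finset.mem_filter, Finset.mem_product, Finset.mem_range] at hp
      obtain ⟨⟨_, hq⟩, hpq, hpqk⟩ := hp
      refine (hg p q hpq hq).2 ?_
      rcases lt_trichotomy p i with h | h | h
      · exact (mul_eq_zero.1 (hprod p q i j h hij (by omega) hq hpqk hijk)).resolve_right hne
      · exact absurd (Prod.ext h (by simp only; omega)) hpne
      · exact (mul_eq_zero.1 (hprod i j p q h hpq (by omega) hj hijk hpqk)).resolve_left hne
    · intro hnot
      exfalso; apply hnot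
      simp only [Finset.mem_filter, Finset.mem_product, Finset.mem_range]
      omega

/-- `f` cuts out the vanishing of the 2-minors of columns `< n`. -/
def Cuts.{u} {R : Type u} [CommRing R] (n : ℕ) (a b : ℕ → R) (f : ℕ → R) : Prop :=
  ∀ (L : Type u) [Field L] [IsAlgClosed L] (φ : R →+* L),
    (∀ k, k < 2 * n - 4 → φ (f k) = 0) ↔ (∀ i j, i < n → j < n → φ (mnr a b i j) = 0)

lemma map_mnr {R S ι : Type*} [CommRing R] [CommRing S] (φ : R →+* S) (a b : ι → R) (i j : ι) :
    φ (mnr a b i j) = mnr (fun i => φ (a i)) (fun i => φ (b i)) i j := by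
  simp [mnr]

lemma mnr_swap {R ι : Type*} [CommRing R] (a b : ι → R) (i j : ι) :
    mnr a b i j = - mnr a b j i := by simp [mnr]

lemma all_of_lt {R : Type*} [CommRing R] (n : ℕ) (a b : ℕ → R)
    (h : ∀ i j, i < j → j < n → mnr a b i j = 0) : ∀ i j, i < n → j < n → mnr a b i j = 0 := by
  intro i j hi hj
  rcases lt_trichotomy i j with h1 | h1 | h1
  · exact h i j h1 hj
  · subst h1; simp [mnr]
  · rw [mnr_swap, h j i h1 hi, neg_zero]

/-- The case of a zero entry. -/
lemma cuts_zero {R : Type*} [CommRing R] (m : ℕ) (a b : ℕ → R) (h0 : a (m + 1) = 0) :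
    ∃ f, Cuts (m + 3) a b f := by
  -- columns: `m`, `m+1 = (0, r)`, `m+2`
  let a' : ℕ → R := fun i => if i = m + 1 then b m * a (m + 2) else a i
  let b' : ℕ → R := fun i => if i = m + 1 then b m * b (m + 2) - b (m + 1) else b i
  let E : R := b (m + 1) * a (m + 2) + b (m + 2) * mnr a b (m + 2) m
  refine ⟨fun k => if k = 0 then E else dsum (m + 3) (mnr a' b') k, ?_⟩
  intro L _ _ φ
  -- column operation
  have hcol : (∀ i j, i < m + 3 → j < m + 3 → φ (mnr a b i j) = 0) →
      ∀ i j, i < m + 3 → j < m + 3 → φ (mnr a' b' i j) = 0 := by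
    intro h i j hi hj
    by_cases hi1 : i = m + 1 <;> by_cases hj1 : j = m + 1
    · subst hi1; subst hj1; simp [mnr]
    · have e : mnr a' b' i j = b m * mnr a b (m + 2) j - mnr a b (m + 1) j := by
        simp only [mnr, a', b', hi1, hj1, if_true, if_false, h0]; ring
      rw [e, map_sub, map_mul, h _ _ (by omega) hj, h _ _ (by omega) hj]; ring
    · have e : mnr a' b' i j = b m * mnr a b i (m + 2) - mnr a b i (m + 1) := by
        simp only [mnr, a', b', hi1, hj1, if_true, if_false, h0]; ring
      rw [e, map_sub, map_mul, h _ _ hi (by omega), h _ _ hi (by omega)]; ring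
    · have e : mnr a' b' i j = mnr a b i j := by
        simp only [mnr, a', b', hi1, hj1, if_false]
      rw [e, h _ _ hi hj]
  have hcol' : (∀ i j, i < m + 3 → j < m + 3 → φ (mnr a' b' i j) = 0) →
      ∀ i j, i < m + 3 → j < m + 3 → φ (mnr a b i j) = 0 := by
    intro h i j hi hj
    by_cases hi1 : i = m + 1 <;> by_cases hj1 : j = m + 1
    · subst hi1; subst hj1; simp [mnr]
    · have e : mnr a b i j = b m * mnr a' b' (m + 2) j - mnr a' b' (m + 1) j := by
        simp [mnr, a', b', hi1, hj1, h0]; ring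
      rw [e, map_sub, map_mul, h _ _ (by omega) hj, h _ _ (by omega) hj]; ring
    · have e : mnr a b i j = b m * mnr a' b' i (m + 2) - mnr a' b' i (m + 1) := by
        simp [mnr, a', b', hi1, hj1, h0]; ring
      rw [e, map_sub, map_mul, h _ _ hi (by omega), h _ _ hi (by omega)]; ring
    · have e : mnr a b i j = mnr a' b' i j := by
        simp only [mnr, a', b', hi1, hj1, if_false]
      rw [e, h _ _ hi hj]
  constructor
  · intro h
    apply hcol'
    have hE : φ E = 0 := by simpa using h 0 (by omega)
    have hS : ∀ k, 1 ≤ k → k ≤ 2 * m + 1 →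
        dsum (m + 3) (mnr (fun i => φ (a' i)) (fun i => φ (b' i))) k = 0 := by
      intro k h1 h2
      have := h k (by omega)
      simp only [show k ≠ 0 by omega, if_false] at this
      rw [map_dsum] at this
      simpa only [map_mnr] using this
    have hc := chain (fun i => φ (a' i)) (fun i => φ (b' i)) _ (m + 3) (2 * m + 1)
      (fun _ _ _ _ => Iff.rfl) hS
    have h2 : φ (mnr a' b' m (m + 1)) = 0 := by
      rw [map_mnr]; exact hc _ (by omega) m (m + 1) (by omega) (by omega) rfl
    have e2 : mnr a' b' m (m + 1) = -(b (m + 1) * a m + b m * mnr a b (m + 2) m) := by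
      simp [mnr, a', b']; ring
    rw [e2, map_neg, neg_eq_zero] at h2
    have hD : φ (mnr a b (m + 2) m) = 0 := by
      have e : mnr a b (m + 2) m * mnr a b (m + 2) m =
          a (m + 2) * (b (m + 1) * a m + b m * mnr a b (m + 2) m) - a m * E := by
        simp only [E, mnr]; ring
      have := congrArg φ e
      rw [map_sub, map_mul, map_mul, map_mul, h2, hE] at this
      simpa using this
    have h3 : φ (b (m + 1)) * φ (a (m + 2)) = 0 := by
      simpa [E, hD] using hE
    intro i j hi hj
    rw [map_mnr]
    refine all_of_lt (m + 3) _ _ ?_ i j hi hj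
    clear hi hj i j
    intro i j hij hj
    by_cases hs : i + j ≤ 2 * m + 1
    · exact hc _ hs i j hij hj rfl
    · rw [← map_mnr]
      have hj' : j = m + 2 := by omega
      have hi' : i = m ∨ i = m + 1 := by omega
      subst hj'
      rcases hi' with rfl | rfl
      · have e : mnr a' b' i (i + 2) = - mnr a b (i + 2) i := by simp [mnr, a', b']
        rw [e, map_neg, hD, neg_zero]
      · have e : mnr a' b' (m + 1) (m + 2) = b (m + 1) * a (m + 2) := by
          simp [mnr, a', b']; ring
        rw [e, map_mul, h3]
  · intro h k hk
    by_cases h1 : k = 0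
    · have e : E = - mnr a b (m + 1) (m + 2) + b (m + 2) * mnr a b (m + 2) m := by
        simp [E, mnr, h0]; ring
      simp only [h1, if_true]
      rw [e, map_add, map_neg, map_mul, h _ _ (by omega) (by omega), h _ _ (by omega) (by omega)]
      ring
    · simp only [h1, if_false]
      rw [map_dsum]
      apply dsum_eq_zero
      intro i j hij hj
      exact hcol h i j (by omega) hj

/-- The case of a symmetric block. -/
lemma cuts_sym {R : Type*} [CommRing R] (m : ℕ) (a b : ℕ → R) (h0 : a (m + 2) = b 0) :
    ∃ f, Cuts (m + 3) a b f := by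
  let g : ℕ → ℕ → R := fun i j =>
    if i = 0 then b j * mnr a b 0 j - a j * mnr a b (m + 2) j else mnr a b i j
  refine ⟨fun k => if k = 0 then mnr a b 0 (m + 2) else dsum (m + 2) g k, ?_⟩
  intro L _ _ φ
  constructor
  · intro h
    have hQ : φ (mnr a b 0 (m + 2)) = 0 := by simpa using h 0 (by omega)
    obtain ⟨s, t, hx, hy, hw⟩ : ∃ s t : L, φ (a 0) = s * s ∧ φ (b 0) = s * t ∧
        φ (b (m + 2)) = t * t := by
      simp only [mnr, map_sub, map_mul, h0] at hQ
      obtain ⟨s, hs⟩ := IsAlgClosed.exists_pow_nat_eq (φ (a 0)) (n := 2) (by norm_num)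
      by_cases h1 : s = 0
      · obtain ⟨t, ht⟩ := IsAlgClosed.exists_pow_nat_eq (φ (b (m + 2))) (n := 2) (by norm_num)
        refine ⟨s, t, by rw [← hs]; ring, ?_, by rw [← ht]; ring⟩
        rw [← hs, h1] at hQ
        have : φ (b 0) = 0 := by simpa using hQ
        rw [this, h1]; ring
      · refine ⟨s, φ (b 0) / s, by rw [← hs]; ring, by field_simp, ?_⟩
        rw [← hs] at hQ
        field_simp
        linear_combination hQ
    let a' : ℕ → L := fun i => if i = 0 then s else φ (a i)
    let b' : ℕ → L := fun i => if i = 0 then t else φ (b i)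
    have hg : ∀ i j, i < j → j < m + 2 → (φ (g i j) = 0 ↔ mnr a' b' i j = 0) := by
      intro i j hij hj
      by_cases hi : i = 0
      · have hj0 : j ≠ 0 := by omega
        have e : φ (g i j) = mnr a' b' i j * mnr a' b' i j := by
          simp only [g, a', b', hi, hj0, if_true, if_false, mnr, map_sub, map_mul, h0, hx, hy, hw]
          ring
        rw [e, mul_self_eq_zero]
      · have hj0 : j ≠ 0 := by omega
        simp only [g, a', b', hi, hj0, if_false, mnr, map_sub, map_mul]
    have hS : ∀ k, 1 ≤ k → k ≤ 2 * m + 1 → dsum (m + 2) (fun i j => φ (g i j)) k = 0 := by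
      intro k h1 h2
      have := h k (by omega)
      simp only [show k ≠ 0 by omega, if_false] at this
      rwa [map_dsum] at this
    have hc := chain a' b' _ (m + 2) (2 * m + 1) hg hS
    have hc2 : ∀ i j, i < j → j < m + 2 → mnr a' b' i j = 0 := fun i j hij hj =>
      hc (i + j) (by omega) i j hij hj rfl
    intro i j hi hj
    rw [map_mnr]
    refine all_of_lt (m + 3) _ _ ?_ i j hi hj
    clear hi hj i j
    intro i j hij hj
    by_cases hj2 : j = m + 2
    · subst hj2
      by_cases hi : i = 0
      · subst hi; rw [← map_mnr]; exact hQ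
      · have := hc2 0 i (by omega) (by omega)
        simp only [mnr, a', b', hi, if_true, if_false] at this
        simp only [mnr, h0, hy, hw]
        linear_combination (-t) * this
    · by_cases hi : i = 0
      · subst hi
        have hj0 : j ≠ 0 := by omega
        have := hc2 0 j (by omega) (by omega)
        simp only [mnr, a', b', hj0, if_true, if_false] at this
        simp only [mnr, hx, hy]
        linear_combination s * this
      · have hj0 : j ≠ 0 := by omega
        have := hc2 i j (by omega) (by omega)
        simpa only [mnr, a', b', hi, hj0, if_false] using this
  · intro h k hk
    by_cases h1 : k = 0
    · simp only [h1, if_true]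
      exact h _ _ (by omega) (by omega)
    · simp only [h1, if_false]
      rw [map_dsum]
      apply dsum_eq_zero
      intro i j hij hj
      by_cases hi : i = 0
      · simp only [g, hi, if_true]
        rw [map_sub, map_mul, map_mul, h _ _ (by omega) (by omega), h _ _ (by omega) (by omega)]
        ring
      · simp only [g, hi, if_false]
        exact h _ _ (by omega) (by omega)

/-- Radicals agree if vanishing loci over algebraically closed fields agree. -/
lemma radical_le_of_cuts.{u} {R : Type u} [CommRing R] (s t : Set R)
    (h : ∀ (L : Type u) [Field L] [IsAlgClosed L] (φ : R →+* L),
      (∀ x ∈ s, φ x = 0) → (∀ x ∈ t, φ x = 0)) :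
    (Ideal.span t).radical ≤ (Ideal.span s).radical := by
  rw [Ideal.radical_eq_sInf (Ideal.span s)]
  refine le_sInf ?_
  rintro P ⟨hP, hprime⟩
  refine hprime.radical_le_iff.2 (Ideal.span_le.2 ?_)
  let φ : R →+* AlgebraicClosure (FractionRing (R ⧸ P)) :=
    (algebraMap (FractionRing (R ⧸ P)) _).comp
      ((algebraMap (R ⧸ P) (FractionRing (R ⧸ P))).comp (Ideal.Quotient.mk P))
  have hφ : ∀ x, φ x = 0 ↔ x ∈ P := by
    intro x
    simp only [φ, RingHom.comp_apply]
    rw [map_eq_zero, IsFractionRing.to_map_eq_zero_iff, Ideal.Quotient.eq_zero_iff_mem]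
  intro x hx
  exact (hφ x).1 (h _ φ (fun y hy => (hφ y).2 (hP (Ideal.subset_span hy))) x hx)

/-- basis extension with prescribed first vectors -/
lemma exists_basis_ext {K : Type*} [Field K] (n r m : ℕ) (hn : r + m = n)
    (v : Fin r → (Fin n → K)) (hv : LinearIndependent K v) :
    ∃ b : Module.Basis (Fin n) K (Fin n → K),
      ∀ i : Fin r, b ⟨i, by have := i.2; omega⟩ = v i := by
  classical
  subst hn
  let B := Module.Basis.sumExtend hv
  have hBv : ∀ i, B (Sum.inl i) = v i := by
    intro i
    simp [B, Module.Basis.sumExtend]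
    rfl
  have : Finite (Fin r ⊕ Module.Basis.sumExtendIndex hv) := Module.Finite.finite_basis B
  have : Finite (Module.Basis.sumExtendIndex hv) :=
    Finite.of_injective (Sum.inr : _ → Fin r ⊕ Module.Basis.sumExtendIndex hv) Sum.inr_injective
  have : Fintype (Module.Basis.sumExtendIndex hv) := Fintype.ofFinite _
  have hcard := Module.finrank_eq_nat_card_basis B
  rw [Module.finrank_fin_fun, Nat.card_sum] at hcard
  simp only [Nat.card_eq_fintype_card, Fintype.card_fin] at hcard
  let e : Module.Basis.sumExtendIndex hv ≃ Fin m := Fintype.equivFinOfCardEq (by omega)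
  refine ⟨B.reindex ((Equiv.sumCongr (Equiv.refl _) e).trans finSumFinEquiv), fun i => ?_⟩
  rw [Module.Basis.reindex_apply]
  have : ((Equiv.sumCongr (Equiv.refl _) e).trans finSumFinEquiv).symm (Fin.castAdd m i)
      = Sum.inl i := by
    rw [Equiv.symm_apply_eq]; simp
  exact (congrArg B this).trans (hBv i)

/-- vanishing of minors can be tested on a basis -/
lemma bil_basis {K R L ι κ : Type*} [Field K] [CommRing R] [Algebra K R] [CommRing L]
    {V : Type*} [AddCommGroup V] [Module K V]
    (T U : V →ₗ[K] R) (φ : R →+* L) (b : Module.Basis ι K V) (c : κ → V)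
    (h : ∀ i j, φ (mnr (fun i => T (b i)) (fun i => U (b i)) i j) = 0) (i j : κ) :
    φ (mnr (fun i => T (c i)) (fun i => U (c i)) i j) = 0 := by
  simp only [mnr] at h ⊢
  have key : ∀ v w : V, φ (T v * U w - T w * U v) = 0 := by
    have h1 : ∀ (j : ι) (v : V), φ (T v * U (b j) - T (b j) * U v) = 0 := by
      intro j v
      have hv : v ∈ Submodule.span K (Set.range b) := by rw [b.span_eq]; trivial
      induction hv using Submodule.span_induction with
      | mem x hx => obtain ⟨i, rfl⟩ := hx; exact h i j
      | zero => simp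
      | add x y _ _ hx hy =>
        have : T (x + y) * U (b j) - T (b j) * U (x + y) =
          (T x * U (b j) - T (b j) * U x) + (T y * U (b j) - T (b j) * U y) := by
            rw [map_add, map_add]; ring
        rw [this, map_add, hx, hy, add_zero]
      | smul k x _ hx =>
        have : T (k • x) * U (b j) - T (b j) * U (k • x) =
          algebraMap K R k * (T x * U (b j) - T (b j) * U x) := by
            rw [map_smul, map_smul, Algebra.smul_def, Algebra.smul_def]; ring
        rw [this, map_mul, hx, mul_zero]
    intro v w
    have hw : w ∈ Submodule.span K (Set.range b) := by rw [b.span_eq]; trivial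
    induction hw using Submodule.span_induction with
    | mem x hx => obtain ⟨i, rfl⟩ := hx; exact h1 i v
    | zero => simp
    | add x y _ _ hx hy =>
      have : T v * U (x + y) - T (x + y) * U v =
        (T v * U x - T x * U v) + (T v * U y - T y * U v) := by
          rw [map_add, map_add]; ring
      rw [this, map_add, hx, hy, add_zero]
    | smul k x _ hx =>
      have : T v * U (k • x) - T (k • x) * U v =
        algebraMap K R k * (T v * U x - T x * U v) := by
          rw [map_smul, map_smul, Algebra.smul_def, Algebra.smul_def]; ring
      rw [this, map_mul, hx, mul_zero]
  exact key _ _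

/-- Reduction from a matrix to a base-changed sequence of columns. -/
lemma ara_of_cuts {K : Type*} [Field K] {R : Type*} [CommRing R] [Algebra K R] (n : ℕ)
    (X : Matrix (Fin 2) (Fin n) R)
    (T U : (Fin n → K) →ₗ[K] R) (u : Rˣ)
    (hTU : ∀ i j, mnr (fun i => T (Pi.single i 1)) (fun i => U (Pi.single i 1)) i j
      = u * mnr (X 0) (X 1) i j)
    (b : Module.Basis (Fin n) K (Fin n → K)) (p q : ℕ → R) (σ : Equiv.Perm (Fin n))
    (hp : ∀ i : Fin n, p (σ i) = T (b i)) (hq : ∀ i : Fin n, q (σ i) = U (b i))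
    (f : ℕ → R) (hf : Cuts n p q f) :
    araRank (minorsIdeal 2 X) ≤ 2 * n - 4 := by
  have main : ∀ (L : Type _) [Field L] [IsAlgClosed L] (φ : R →+* L),
      (∀ k : Fin (2 * n - 4), φ (f k) = 0) ↔ ∀ i j, φ (mnr (X 0) (X 1) i j) = 0 := by
    intro L _ _ φ
    have hu : φ (u : R) ≠ 0 := (u.isUnit.map φ).ne_zero
    have e1 : (∀ k : Fin (2 * n - 4), φ (f k) = 0) ↔ ∀ k, k < 2 * n - 4 → φ (f k) = 0 :=
      ⟨fun h k hk => h ⟨k, hk⟩, fun h k => h k k.2⟩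
    have e2 : (∀ i j, i < n → j < n → φ (mnr p q i j) = 0) ↔
        ∀ i j, φ (mnr (fun i => T (b i)) (fun i => U (b i)) i j) = 0 := by
      have e3 : ∀ i j, mnr (fun i => T (b i)) (fun i => U (b i)) i j =
          mnr p q (σ i) (σ j) := by
        intro i j; simp only [mnr, hp, hq]
      constructor
      · intro h i j
        rw [e3]; exact h _ _ (σ i).2 (σ j).2
      · intro h i j hi hj
        have := h (σ.symm ⟨i, hi⟩) (σ.symm ⟨j, hj⟩)
        rw [e3] at this
        simpa using this
    rw [e1, hf L φ, e2]
    constructor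
    · intro h i j
      have := bil_basis T U φ b (fun i : Fin n => Pi.single i (1 : K)) h i j
      rw [hTU, map_mul] at this
      exact (mul_eq_zero.1 this).resolve_left hu
    · intro h i j
      refine bil_basis T U φ (Pi.basisFun K (Fin n)) b ?_ i j
      intro i j
      simp only [Pi.basisFun_apply]
      rw [hTU, map_mul, h, mul_zero]
  apply Nat.sInf_le
  refine ⟨fun k => f k, ?_⟩
  unfold minorsIdeal
  have det_eq : ∀ (r : Fin 2 → Fin 2) (c : Fin 2 → Fin n), (X.submatrix r c).det =
      X (r 0) (c 0) * X (r 1) (c 1) - X (r 0) (c 1) * X (r 1) (c 0) := by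
    intro r c; rw [Matrix.det_fin_two]; rfl
  apply le_antisymm
  · apply radical_le_of_cuts
    intro L _ _ φ h
    have : ∀ i j, φ (mnr (X 0) (X 1) i j) = 0 := by
      intro i j
      by_cases hij : i = j
      · subst hij; simp [mnr]
      · apply h
        refine ⟨id, ![i, j], Function.injective_id, ?_, ?_⟩
        · intro x y
          fin_cases x <;> fin_cases y <;> simp [hij, Ne.symm hij]
        · rw [det_eq]; simp [mnr]
    rintro _ ⟨k, rfl⟩
    exact (main L φ).2 this k
  · apply radical_le_of_cuts
    intro L _ _ φ h
    have h' := (main L φ).1 (fun k => h _ ⟨k, rfl⟩)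
    rintro _ ⟨r, c, hr, -, rfl⟩
    rw [det_eq]
    have hr01 : r 0 ≠ r 1 := fun h => by simpa using hr h
    have : (r 0 = 0 ∧ r 1 = 1) ∨ (r 0 = 1 ∧ r 1 = 0) := by omega
    rcases this with ⟨h0, h1⟩ | ⟨h0, h1⟩
    · rw [h0, h1]; exact h' (c 0) (c 1)
    · rw [h0, h1]
      have := h' (c 1) (c 0)
      simp only [mnr] at this
      rw [← this]; congr 1; ring

/-- the linear map of a row -/
def rowMap {K R : Type*} [Field K] [CommRing R] [Algebra K R] {n : ℕ} (x : Fin n → R) :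
    (Fin n → K) →ₗ[K] R := Fintype.linearCombination K x

lemma rowMap_single {K R : Type*} [Field K] [CommRing R] [Algebra K R] {n : ℕ} (x : Fin n → R)
    (i : Fin n) : rowMap (K := K) x (Pi.single i 1) = x i := by
  simp [rowMap]

lemma rowMap_apply {K R : Type*} [Field K] [CommRing R] [Algebra K R] {n : ℕ} (x : Fin n → R)
    (v : Fin n → K) : rowMap (K := K) x v = ∑ i, v i • x i := by
  simp [rowMap, Fintype.linearCombination_apply]

lemma ext_seq {R : Type*} [CommRing R] {n : ℕ} (σ : Equiv.Perm (Fin n)) (y : Fin n → R) :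
    ∃ p : ℕ → R, ∀ i : Fin n, p (σ i) = y i :=
  ⟨fun k => if h : k < n then y (σ.symm ⟨k, h⟩) else 0, fun i => by simp⟩

/-- rank one relation -/
lemma ara_rank_one {K : Type*} [Field K] {R : Type*} [CommRing R] [Algebra K R] (m : ℕ)
    (X : Matrix (Fin 2) (Fin (m + 3)) R) (u0 u1 : K) (v : Fin (m + 3) → K)
    (hu : u0 ≠ 0 ∨ u1 ≠ 0) (hv : v ≠ 0)
    (h : u0 • rowMap (K := K) (X 0) v + u1 • rowMap (K := K) (X 1) v = 0) :
    araRank (minorsIdeal 2 X) ≤ 2 * (m + 3) - 4 := by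
  obtain ⟨w0, w1, hw⟩ : ∃ w0 w1 : K, u0 * w1 - u1 * w0 = 1 := by
    rcases hu with hu | hu
    · exact ⟨0, u0⁻¹, by field_simp; ring⟩
    · exact ⟨-u1⁻¹, 0, by field_simp; ring⟩
  have h13 : 1 + (m + 2) = m + 3 := by omega
  obtain ⟨b, hb⟩ : ∃ b : Module.Basis (Fin (m + 3)) K (Fin (m + 3) → K), b 0 = v := by
    obtain ⟨b, hb⟩ := exists_basis_ext (K := K) (m + 3) 1 (m + 2) h13 (fun _ => v)
      (LinearIndependent.of_subsingleton 0 hv)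
    exact ⟨b, hb 0⟩
  let T := u0 • rowMap (K := K) (X 0) + u1 • rowMap (K := K) (X 1)
  let U := w0 • rowMap (K := K) (X 0) + w1 • rowMap (K := K) (X 1)
  let σ : Equiv.Perm (Fin (m + 3)) := Equiv.swap 0 ⟨m + 1, by omega⟩
  obtain ⟨p, hp⟩ := ext_seq σ (fun i => T (b i))
  obtain ⟨q, hq⟩ := ext_seq σ (fun i => U (b i))
  have hp0 : p (m + 1) = 0 := by
    have := hp 0
    simp only [σ, Equiv.swap_apply_left] at this
    rw [this, hb]
    simpa [T] using h
  obtain ⟨f, hf⟩ := cuts_zero m p q hp0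
  refine ara_of_cuts (m + 3) X T U 1 ?_ b p q σ hp hq f hf
  intro i j
  simp only [mnr, T, U, LinearMap.add_apply, LinearMap.smul_apply, rowMap_single, Units.val_one,
    Algebra.smul_def]
  have hw' := congrArg (algebraMap K R) hw
  simp only [map_sub, map_mul, map_one] at hw'
  linear_combination (X 0 i * X 1 j - X 0 j * X 1 i) * hw'

/-- rank two relation -/
lemma ara_rank_two {K : Type*} [Field K] {R : Type*} [CommRing R] [Algebra K R] (m : ℕ)
    (X : Matrix (Fin 2) (Fin (m + 3)) R) (v w : Fin (m + 3) → K)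
    (hvw : LinearIndependent K ![v, w])
    (h : rowMap (K := K) (X 0) w = rowMap (K := K) (X 1) v) :
    araRank (minorsIdeal 2 X) ≤ 2 * (m + 3) - 4 := by
  have h23 : 2 + (m + 1) = m + 3 := by omega
  obtain ⟨b, hb0, hb1⟩ : ∃ b : Module.Basis (Fin (m + 3)) K (Fin (m + 3) → K),
      b 0 = v ∧ b 1 = w := by
    obtain ⟨b, hb⟩ := exists_basis_ext (K := K) (m + 3) 2 (m + 1) h23 ![v, w] hvw
    exact ⟨b, hb 0, hb 1⟩
  let T := rowMap (K := K) (X 0)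
  let U := rowMap (K := K) (X 1)
  let σ : Equiv.Perm (Fin (m + 3)) := Equiv.swap 1 ⟨m + 2, by omega⟩
  obtain ⟨p, hp⟩ := ext_seq σ (fun i => T (b i))
  obtain ⟨q, hq⟩ := ext_seq σ (fun i => U (b i))
  have hp0 : p (m + 2) = q 0 := by
    have h1 := hp 1
    have h2 := hq 0
    have h3 : σ 0 = 0 := Equiv.swap_apply_of_ne_of_ne (by simp [Fin.ext_iff])
      (by simp [Fin.ext_iff])
    simp only [σ, Equiv.swap_apply_left] at h1
    rw [h3] at h2
    rw [h1, hb1]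
    simp only [Fin.val_zero] at h2
    rw [h2, hb0]
    exact h
  obtain ⟨f, hf⟩ := cuts_sym m p q hp0
  refine ara_of_cuts (m + 3) X T U 1 ?_ b p q σ hp hq f hf
  intro i j
  simp only [mnr, T, U, rowMap_single, Units.val_one, one_mul]

/-- If `X` is a `(2 × n)`-matrix (`n ≥ 3`) of linear forms that are linearly dependent
over the algebraically closed field `K`, then `ara I_2(X) ≤ 2n - 4`. -/
theorem stmt8 {K : Type*} [Field K] [IsAlgClosed K] (N n : ℕ) (hn : 3 ≤ n)
    (X : Matrix (Fin 2) (Fin n) (MvPolynomial (Fin N) K))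
    (hlin : ∀ (i : Fin 2) (j : Fin n), (X i j).IsHomogeneous 1)
    (hdep : ∃ c : Fin 2 × Fin n → K, c ≠ 0 ∧ ∑ p : Fin 2 × Fin n, c p • X p.1 p.2 = 0) :
    araRank (minorsIdeal 2 X) ≤ 2 * n - 4 := by
  obtain ⟨m, rfl⟩ : ∃ m, n = m + 3 := ⟨n - 3, by omega⟩
  obtain ⟨c, hc, hsum⟩ := hdep
  let c0 : Fin (m + 3) → K := fun j => c (0, j)
  let c1 : Fin (m + 3) → K := fun j => c (1, j)
  have hrel : rowMap (K := K) (X 0) c0 + rowMap (K := K) (X 1) c1 = 0 := by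
    rw [rowMap_apply, rowMap_apply, ← hsum, Fintype.sum_prod_type, Fin.sum_univ_two]
  by_cases hli : LinearIndependent K ![c1, -c0]
  · refine ara_rank_two m X c1 (-c0) hli ?_
    rw [map_neg]
    linear_combination (-1 : MvPolynomial (Fin N) K) * hrel
  · by_cases h1 : c1 = 0
    · have h0 : c0 ≠ 0 := by
        intro h0
        apply hc
        ext ⟨i, j⟩
        fin_cases i
        · exact congrFun h0 j
        · exact congrFun h1 j
      refine ara_rank_one m X 1 0 c0 (Or.inl one_ne_zero) h0 ?_
      rw [h1, map_zero, add_zero] at hrel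
      simp [hrel]
    · rw [LinearIndependent.pair_iff' h1] at hli
      push Not at hli
      obtain ⟨k, hk⟩ := hli
      refine ara_rank_one m X (-k) 1 c1 (Or.inr one_ne_zero) h1 ?_
      have h0 : c0 = (-k) • c1 := by rw [neg_smul, hk, neg_neg]
      rw [h0, map_smul] at hrel
      rw [one_smul, hrel]
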